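/- Let (R, 𝔪) be a two-dimensional regular local ring with infinite residue field, and let J and K be integrally closed 𝔪-primary ideals of R of orders 1 and 2 respectively such that (1) λ(R/JK) − λ(R/J) − λ(R/K) = 2 and (2) 𝔪^2 = J𝔪 + K. Suppose M is an integrally closed finitely generated torsion-free R-module of rank 3 without free direct summands whose ideal of maximal minors is I(M) = JK. Then M is decomposable. -/

import Mathlib

open IsLocalRing

section Defs

variable {R : Type*} [CommRing R]

/-- `R` is a two-dimensional regular local ring: Noetherian local of Krull dimension 2
whose maximal ideal is generated by two elements. -/
def IsTwoDimRegularLocal (R : Type*) [CommRing R] [IsLocalRing R] : Prop :=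
  IsNoetherianRing R ∧ ringKrullDim R = 2 ∧
    ∃ x y : R, maximalIdeal R = Ideal.span {x, y}

/-- `z` lies in the integral closure of the ideal `I`, i.e. it satisfies an equation
`z ^ n + c 1 * z ^ (n-1) + ⋯ + c n = 0` with `c i ∈ I ^ i`. -/
def MemIntClosure (I : Ideal R) (z : R) : Prop :=
  ∃ n : ℕ, 0 < n ∧ ∃ c : ℕ → R, (∀ i ∈ Finset.Icc 1 n, c i ∈ I ^ i) ∧
    z ^ n + ∑ i ∈ Finset.Icc 1 n, c i * z ^ (n - i) = 0

/-- The ideal `I` is integrally closed. -/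
def IdealIntClosed (I : Ideal R) : Prop := ∀ z, MemIntClosure I z → z ∈ I

/-- `I` is `𝔪`-primary. -/
def IsMPrimary [IsLocalRing R] (I : Ideal R) : Prop := I.radical = maximalIdeal R

/-- `ord I = n` : `n` is the largest power of the maximal ideal containing `I`. -/
def ordEQ [IsLocalRing R] (I : Ideal R) (n : ℕ) : Prop :=
  I ≤ maximalIdeal R ^ n ∧ ¬ I ≤ maximalIdeal R ^ (n + 1)

/-- Determinant of the square matrix with columns `w 0, …, w (r-1)`. -/
def colDet {r : ℕ} (w : Fin r → Fin r → R) : R :=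
  Matrix.det (Matrix.of fun i j => w j i)

/-- The ideal of maximal minors `I(M)` of a submodule `M ⊆ R^r`:  it is generated by all
determinants of `r × r` matrices whose columns lie in `M`. -/
def maxMinors {r : ℕ} (M : Submodule R (Fin r → R)) : Ideal R :=
  Ideal.span { d | ∃ w : Fin r → Fin r → R, (∀ j, w j ∈ M) ∧ d = colDet w }

/-- The ideal `I_k(M)` of `k × k` minors of a matrix whose columns generate `M ⊆ R^r`. -/
def minorsIdeal (k : ℕ) {r : ℕ} (M : Submodule R (Fin r → R)) : Ideal R :=
  Ideal.span { d | ∃ (w : Fin k → Fin r → R) (ρ : Fin k → Fin r),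
    Function.Injective ρ ∧ (∀ j, w j ∈ M) ∧
    d = Matrix.det (Matrix.of fun i j : Fin k => w j (ρ i)) }

/-- `v ∈ R^r` is integral over the submodule `M ⊆ R^r` : the determinant of every square
matrix with one column `v` and the remaining columns in `M` is integral over `I(M)`. -/
def IntegralOverMod {r : ℕ} (M : Submodule R (Fin r → R)) (v : Fin r → R) : Prop :=
  ∀ (w : Fin r → Fin r → R) (j₀ : Fin r), w j₀ = v → (∀ j, j ≠ j₀ → w j ∈ M) →
    MemIntClosure (maxMinors M) (colDet w)

/-- The submodule `M ⊆ R^r` is integrally closed. -/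
def ModIntClosed {r : ℕ} (M : Submodule R (Fin r → R)) : Prop :=
  ∀ v, IntegralOverMod M v → v ∈ M

/-- The length of an `R`-module, as the Krull dimension of its submodule lattice. -/
noncomputable def modLength (R : Type*) (M : Type*) [CommRing R] [AddCommGroup M]
    [Module R M] : WithBot ℕ∞ :=
  Order.krullDim (Submodule R M)

/-- `M ⊆ R^r` has finite colength; equivalently, `M` is a finitely generated torsion-free
module of rank `r` with double dual `M** = R^r`. -/
def FinColength {r : ℕ} (M : Submodule R (Fin r → R)) : Prop :=
  IsFiniteLength R ((Fin r → R) ⧸ M)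

/-- `M` has a nonzero free direct summand. -/
def HasFreeSummand {r : ℕ} (M : Submodule R (Fin r → R)) : Prop :=
  ∃ N P : Submodule R (Fin r → R), N ⊔ P = M ∧ N ⊓ P = ⊥ ∧ N ≠ ⊥ ∧ Module.Free R ↥N

/-- `M` is a direct sum of two nonzero submodules. -/
def DecomposableSub {r : ℕ} (M : Submodule R (Fin r → R)) : Prop :=
  ∃ N P : Submodule R (Fin r → R), N ⊔ P = M ∧ N ⊓ P = ⊥ ∧ N ≠ ⊥ ∧ P ≠ ⊥

/-- `M` is nonzero and not a direct sum of two nonzero submodules. -/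
def IndecomposableSub {r : ℕ} (M : Submodule R (Fin r → R)) : Prop :=
  M ≠ ⊥ ∧ ¬ DecomposableSub M

/-- `a` is a minimal generating set of the ideal `I`. -/
def MinGens {m : ℕ} (I : Ideal R) (a : Fin m → R) : Prop :=
  Ideal.span (Set.range a) = I ∧ ∀ j : Fin m, Ideal.span (a '' {j}ᶜ) ≠ I

/-- `a = c 0 * x^(r-1) + c 1 * x^(r-2) * y + ⋯ + c (r-1) * y^(r-1)`. -/
def Expresses (r : ℕ) (x y : R) (c : Fin r → R) (a : R) : Prop :=
  a = ∑ i : Fin r, c i * x ^ (r - 1 - (i : ℕ)) * y ^ (i : ℕ)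

/-- The `k`-th Koszul relation column between `x^(r-1), …, y^(r-1)`:
`y` in position `k` and `-x` in position `k+1`. -/
def stdRelCol (r : ℕ) (x y : R) (k : ℕ) : Fin r → R :=
  fun i => if (i : ℕ) = k then y else if (i : ℕ) = k + 1 then -x else 0

/-- The module generated by the coefficient columns `C j` together with the `r - 1`
Koszul relation columns between `x^(r-1), …, y^(r-1)`. -/
def MrSpan (r : ℕ) (x y : R) {m : ℕ} (C : Fin m → Fin r → R) :
    Submodule R (Fin r → R) :=
  Submodule.span R (Set.range C ∪ { v | ∃ k, k < r - 1 ∧ v = stdRelCol r x y k })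

/-- The data `(x, y, a, C)` presents the module `M_r(I)` : `𝔪 = (x,y)`, `a` is a minimal
generating set of `I` and column `C j` expresses `a j` in terms of `x^(r-1), …, y^(r-1)`. -/
def IsMrPresentation [IsLocalRing R] (r : ℕ) (I : Ideal R) {m : ℕ} (x y : R)
    (a : Fin m → R) (C : Fin m → Fin r → R) : Prop :=
  maximalIdeal R = Ideal.span {x, y} ∧ MinGens I a ∧ ∀ j, Expresses r x y (C j) (a j)

/-- `N` is a reduction of `M` : `N ≤ M` and every element of `M` is integral over `N`. -/
def IsReductionMod {r : ℕ} (N M : Submodule R (Fin r → R)) : Prop :=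
  N ≤ M ∧ ∀ v ∈ M, IntegralOverMod N v

/-- `N` is a minimal reduction of `M`. -/
def IsMinimalReductionMod {r : ℕ} (N M : Submodule R (Fin r → R)) : Prop :=
  IsReductionMod N M ∧ ∀ N' ≤ N, IsReductionMod N' M → N' = N

/-- The `j`-th signed maximal minor of an `r × (r+1)` matrix. -/
def signedMinor {r : ℕ} (A : Matrix (Fin r) (Fin (r + 1)) R) (j : Fin (r + 1)) : R :=
  (-1 : R) ^ (j : ℕ) * (A.submatrix id j.succAbove).det

/-- `M ⊆ R^r` is extremal: integrally closed, without free direct summands, with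
`λ(R/I(M)) = λ(R^r/M) + r(r-1)/2`. -/
def IsExtremal {r : ℕ} (M : Submodule R (Fin r → R)) : Prop :=
  FinColength M ∧ ModIntClosed M ∧ ¬ HasFreeSummand M ∧
    modLength R (R ⧸ maxMinors M) =
      modLength R ((Fin r → R) ⧸ M) + ((r * (r - 1) / 2 : ℕ) : WithBot ℕ∞)

/-- `a ∈ J`, `b ∈ K` is a joint reduction of the pair `(J, K)`. -/
def IsJointReduction (J K : Ideal R) (a b : R) : Prop :=
  a ∈ J ∧ b ∈ K ∧ ∃ n : ℕ,
    (Ideal.span {a} * K + Ideal.span {b} * J) * (J * K) ^ n = (J * K) ^ (n + 1)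

/-- `S` is the matrix `Sym^k(Q)` for `Q = [[a, c], [b, d]]` : with `X = aU + bV`,
`Y = cU + dV`, the `j`-th column of `S` records the coefficients of
`X^(k-j) Y^j` in terms of `U^k, U^(k-1)V, …, V^k`. -/
def IsSymOf (k : ℕ) (a b c d : R) (S : Matrix (Fin (k + 1)) (Fin (k + 1)) R) : Prop :=
  ∀ j : Fin (k + 1),
    ((MvPolynomial.C a * MvPolynomial.X 0 + MvPolynomial.C b * MvPolynomial.X 1) ^ (k - (j : ℕ)) *
        (MvPolynomial.C c * MvPolynomial.X 0 + MvPolynomial.C d * MvPolynomial.X 1) ^ (j : ℕ)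
      : MvPolynomial (Fin 2) R)
    = ∑ i : Fin (k + 1), MvPolynomial.C (S i j) *
        MvPolynomial.X 0 ^ (k - (i : ℕ)) * MvPolynomial.X 1 ^ (i : ℕ)

/-- The `r × s` bidiagonal matrix with `y` on the diagonal and `-x` directly below it. -/
def bidiag (r s : ℕ) (x y : R) : Matrix (Fin r) (Fin s) R :=
  Matrix.of fun i j =>
    if (i : ℕ) = (j : ℕ) then y else if (i : ℕ) = (j : ℕ) + 1 then -x else 0

end Defs

section Param

variable {R : Type*} [CommRing R] [IsLocalRing R]

/-- `x, y` is a system of two generators of the maximal ideal such that `(x)` is a prime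
ideal not containing `y`. -/
structure IsParam (x y : R) : Prop where
  max_eq : maximalIdeal R = Ideal.span {x, y}
  prime : (Ideal.span {x}).IsPrime
  not_mem : y ∉ Ideal.span {x}

lemma exists_form_or {x y : R} (h : maximalIdeal R = Ideal.span {x, y}) (a : R) (n : ℕ) :
    (∃ i < n, ∃ u r, IsUnit u ∧ a = x * r + u * y ^ i) ∨ ∃ r s, a = x * r + s * y ^ n := by
  induction n with
  | zero => exact Or.inr ⟨0, a, by simp⟩
  | succ n ih =>
    rcases ih with ⟨i, hi, h⟩ | ⟨r, s, rfl⟩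
    · exact Or.inl ⟨i, by omega, h⟩
    · by_cases hs : IsUnit s
      · exact Or.inl ⟨n, by omega, s, r, hs, rfl⟩
      · have : s ∈ maximalIdeal R := hs
        rw [h, Ideal.mem_span_pair] at this
        obtain ⟨p, q, rfl⟩ := this
        exact Or.inr ⟨r + p * y ^ n, q, by ring⟩

lemma exists_form [IsNoetherianRing R] {x y : R} (h : maximalIdeal R = Ideal.span {x, y})
    (a : R) (ha : a ∉ Ideal.span {x}) : ∃ (i : ℕ) (u r : R), IsUnit u ∧ a = x * r + u * y ^ i := by
  by_contra! hc
  apply ha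
  rw [← Ideal.Quotient.eq_zero_iff_mem, ← Submodule.mem_bot R,
    ← Ideal.iInf_pow_smul_eq_bot_of_isLocalRing (maximalIdeal R) (M := R ⧸ Ideal.span {x})
    (Ideal.IsPrime.ne_top'), Submodule.mem_iInf]
  intro n
  rcases exists_form_or h a n with ⟨i, _, u, r, hu, he⟩ | ⟨r, s, he⟩
  · exact absurd he (hc i u r hu)
  · have : (Ideal.Quotient.mk (Ideal.span {x})) a =
        y ^ n • (Ideal.Quotient.mk (Ideal.span {x})) s := by
      rw [he, map_add, (Ideal.Quotient.eq_zero_iff_mem).2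
        (Ideal.mul_mem_right _ _ (Ideal.mem_span_singleton_self x)), zero_add, mul_comm,
        Algebra.smul_def]
      simp
    rw [this]
    refine Submodule.smul_mem_smul (Ideal.pow_mem_pow ?_ n) trivial
    rw [h]
    exact Ideal.subset_span (by simp)

lemma not_mem_span_pow (hreg : IsTwoDimRegularLocal R) {x y : R}
    (h : maximalIdeal R = Ideal.span {x, y}) (n : ℕ) : y ^ n ∉ Ideal.span {x} := by
  have := hreg.1
  intro hn
  have hmin : maximalIdeal R ∈ (Ideal.span {x}).minimalPrimes := by
    refine ⟨⟨inferInstance, ?_⟩, fun q hq _ => ?_⟩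
    · rw [h]
      exact Ideal.span_mono (by simp)
    · rw [h, Ideal.span_le]
      have hx := hq.2 (Ideal.mem_span_singleton_self x)
      have hy := hq.1.mem_of_pow_mem n (hq.2 hn)
      rintro z (rfl | rfl)
      · exact hx
      · exact hy
  have h1 := Ideal.height_le_one_of_isPrincipal_of_mem_minimalPrimes _ _ hmin
  have h2 := IsLocalRing.maximalIdeal_height_eq_ringKrullDim (R := R)
  rw [hreg.2.1] at h2
  have h3 : (maximalIdeal R).height = 2 := WithBot.coe_injective h2
  rw [h3] at h1
  exact absurd h1 (by decide)

lemma isParam (hreg : IsTwoDimRegularLocal R) {x y : R}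
    (h : maximalIdeal R = Ideal.span {x, y}) : IsParam x y := by
  have := hreg.1
  refine ⟨h, ⟨fun ht => ?_, fun {a b} hab => ?_⟩, by simpa using not_mem_span_pow hreg h 1⟩
  · exact not_mem_span_pow hreg h 1 (ht ▸ trivial)
  · by_contra! hc
    obtain ⟨i, u, r, hu, rfl⟩ := exists_form h a hc.1
    obtain ⟨j, v, s, hv, rfl⟩ := exists_form h b hc.2
    apply not_mem_span_pow hreg h (i + j)
    rw [← Ideal.unit_mul_mem_iff_mem _ (hu.mul hv)]
    rw [Ideal.mem_span_singleton] at hab ⊢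
    have : u * v * y ^ (i + j) = (x * r + u * y ^ i) * (x * s + v * y ^ j) -
      x * (r * (x * s + v * y ^ j) + u * y ^ i * s) := by ring
    rw [this]
    exact dvd_sub hab (dvd_mul_right _ _)

lemma isDomain_of_isTwoDimRegularLocal (hreg : IsTwoDimRegularLocal R) : IsDomain R := by
  have := hreg.1
  obtain ⟨x, y, h⟩ := hreg.2.2
  have hi (i : ℕ) : maximalIdeal R = Ideal.span {x + y ^ (i + 1), y} := by
    rw [h, pow_succ, Ideal.span_pair_add_mul_right]
  have hp (i : ℕ) := isParam hreg (hi i)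
  have hinj : Function.Injective (fun i : ℕ => Ideal.span {x + y ^ (i + 1)}) := by
    have key (i k : ℕ) : Ideal.span {x + y ^ (i + 1)} ≠ Ideal.span {x + y ^ (i + 1 + k + 1)} := by
      intro he
      have h1 : x + y ^ (i + 1 + k + 1) ∈ Ideal.span {x + y ^ (i + 1)} :=
        he ▸ Ideal.mem_span_singleton_self _
      have hu : IsUnit (1 - y ^ (k + 1)) := by
        apply IsLocalRing.isUnit_one_sub_self_of_mem_nonunits
        change y ^ (k + 1) ∈ maximalIdeal R
        apply Ideal.pow_mem_of_mem _ _ _ (Nat.succ_pos k)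
        rw [h]; exact Ideal.subset_span (by simp)
      apply not_mem_span_pow hreg (hi i) (i + 1)
      rw [← Ideal.unit_mul_mem_iff_mem _ hu]
      convert! Ideal.sub_mem _ (Ideal.mem_span_singleton_self (x + y ^ (i + 1))) h1 using 1
      ring
    intro i j hij
    rcases lt_trichotomy i j with hlt | heq | hlt
    · obtain ⟨k, rfl⟩ := Nat.exists_eq_add_of_lt hlt
      exact absurd (by simpa [add_assoc, add_comm, add_left_comm] using hij) (key i k)
    · exact heq
    · obtain ⟨k, rfl⟩ := Nat.exists_eq_add_of_lt hlt
      exact absurd (by simpa [add_assoc, add_comm, add_left_comm] using hij.symm) (key j k)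
  obtain ⟨i, hmin⟩ : ∃ i : ℕ, Ideal.span {x + y ^ (i + 1)} ∉ minimalPrimes R := by
    by_contra! hc
    exact Set.infinite_of_injective_forall_mem hinj hc (minimalPrimes.finite_of_isNoetherianRing R)
  set z := x + y ^ (i + 1) with hz
  have hzp := (hp i).prime
  obtain ⟨q, hq, hqz⟩ := Ideal.exists_minimalPrimes_le (bot_le (a := Ideal.span {z}))
  have hzq : z ∉ q := fun hzq =>
    hmin (le_antisymm hqz ((Ideal.span_singleton_le_iff_mem _).2 hzq) ▸ hq)
  have hqp : q.IsPrime := hq.1.1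
  have hq0 : q = ⊥ := by
    refine Submodule.eq_bot_of_le_smul_of_le_jacobson_bot (maximalIdeal R) q
      (IsNoetherian.noetherian q) (fun a ha => ?_) (IsLocalRing.maximalIdeal_le_jacobson _)
    obtain ⟨r, rfl⟩ := Ideal.mem_span_singleton.1 (hqz ha)
    refine Submodule.smul_mem_smul ?_ ((hqp.mem_or_mem ha).resolve_left hzq)
    rw [hi i]; exact Ideal.subset_span (by simp [hz])
  rw [hq0] at hqp
  have := hqp
  exact IsDomain.of_bot_isPrime R

end Param

section Param

variable {R : Type*} [CommRing R] [IsLocalRing R]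

namespace IsParam

variable {x y : R} (h : IsParam x y)
include h

lemma left_mem : x ∈ maximalIdeal R := h.max_eq ▸ Ideal.subset_span (by simp)

lemma right_mem : y ∈ maximalIdeal R := h.max_eq ▸ Ideal.subset_span (by simp)

lemma pow_not_mem (n : ℕ) : y ^ n ∉ Ideal.span {x} :=
  fun hn => h.not_mem (h.prime.mem_of_pow_mem n hn)

lemma left_ne_zero [IsNoetherianRing R] (hreg : IsTwoDimRegularLocal R) : x ≠ 0 := by
  rintro rfl
  have hm := h.max_eq
  rw [Ideal.span_pair_comm, Ideal.span_pair_zero] at hm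
  have h1 : (maximalIdeal R).height ≤ 1 := by
    have : (maximalIdeal R).IsPrincipal := ⟨y, hm⟩
    exact Ideal.height_le_one_of_isPrincipal_of_mem_minimalPrimes (maximalIdeal R) _
      (by rw [Ideal.minimalPrimes_eq_subsingleton_self]; rfl)
  have h2 := IsLocalRing.maximalIdeal_height_eq_ringKrullDim (R := R)
  rw [hreg.2.1] at h2
  have h3 : (maximalIdeal R).height = 2 := WithBot.coe_injective h2
  rw [h3] at h1
  exact absurd h1 (by decide)

lemma mem_of_pow_mul_mem {i j : ℕ} {a : R} (ha : y ^ i * a ∈ Ideal.span {x, y ^ (i + j)}) :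
    a ∈ Ideal.span {x, y ^ j} := by
  obtain ⟨p, q, hpq⟩ := Ideal.mem_span_pair.1 ha
  have : y ^ i * (a - q * y ^ j) ∈ Ideal.span {x} :=
    Ideal.mem_span_singleton.2 ⟨p, by linear_combination -hpq⟩
  obtain ⟨r, hr⟩ := Ideal.mem_span_singleton.1
    ((h.prime.mem_or_mem this).resolve_left (h.pow_not_mem i))
  exact Ideal.mem_span_pair.2 ⟨r, q, by linear_combination -hr⟩

lemma exists_of_mem_pow (k : ℕ) {z : R} (hz : z ∈ maximalIdeal R ^ (k + 1)) :
    ∃ m ∈ maximalIdeal R ^ k, ∃ b, z = x * m + b * y ^ (k + 1) := by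
  induction k generalizing z with
  | zero =>
    rw [zero_add, pow_one, h.max_eq, Ideal.mem_span_pair] at hz
    obtain ⟨p, q, rfl⟩ := hz
    exact ⟨p, by simp, q, by ring⟩
  | succ k ih =>
    rw [pow_succ] at hz
    refine Submodule.mul_induction_on hz (fun a ha b hb => ?_) ?_
    · obtain ⟨m, hm, c, rfl⟩ := ih ha
      have hb' := hb
      rw [h.max_eq, Ideal.mem_span_pair] at hb
      obtain ⟨p, q, rfl⟩ := hb
      refine ⟨m * (p * x + q * y) + c * p * y ^ (k + 1), ?_, c * q, by ring⟩
      exact add_mem (by rw [pow_succ]; exact Ideal.mul_mem_mul hm hb')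
        (Ideal.mul_mem_left _ _ (Ideal.pow_mem_pow h.right_mem _))
    · rintro _ _ ⟨m, hm, c, rfl⟩ ⟨m', hm', c', rfl⟩
      exact ⟨m + m', add_mem hm hm', c + c', by ring⟩

lemma pow_le (k : ℕ) : maximalIdeal R ^ k ≤ Ideal.span {x, y ^ k} := by
  cases k with
  | zero => rw [pow_zero, (Ideal.eq_top_iff_one _).2 (Ideal.subset_span (by simp))]; exact le_top
  | succ k =>
    intro z hz
    obtain ⟨m, _, b, rfl⟩ := h.exists_of_mem_pow k hz
    exact Ideal.mem_span_pair.2 ⟨m, b, by ring⟩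

lemma unit_mul_pow_ne {i : ℕ} {u a z : R} (hu : IsUnit u) (hz : z ∈ maximalIdeal R ^ (i + 1)) :
    u * y ^ i ≠ x * a + z := by
  intro he
  have : y ^ i * u ∈ Ideal.span {x, y ^ (i + 1)} := by
    rw [mul_comm, he]
    exact add_mem (Ideal.mul_mem_right _ _ (Ideal.subset_span (by simp))) (h.pow_le _ hz)
  have h1 := h.mem_of_pow_mul_mem this
  rw [pow_one, ← h.max_eq] at h1
  exact h1 hu

lemma mem_pow_of_mul_mem [IsDomain R] (hx : x ≠ 0) {k : ℕ} {a : R}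
    (ha : x * a ∈ maximalIdeal R ^ (k + 1)) : a ∈ maximalIdeal R ^ k := by
  obtain ⟨m, hm, b, hb⟩ := h.exists_of_mem_pow k ha
  have : b * y ^ (k + 1) ∈ Ideal.span {x} :=
    Ideal.mem_span_singleton.2 ⟨a - m, by linear_combination -hb⟩
  obtain ⟨c, rfl⟩ := Ideal.mem_span_singleton.1
    ((h.prime.mem_or_mem this).resolve_right (h.pow_not_mem _))
  have : a = m + c * y ^ (k + 1) := mul_left_cancel₀ hx (by linear_combination hb)
  rw [this]
  exact add_mem hm (Ideal.mul_mem_left _ _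
    (Ideal.pow_le_pow_right (Nat.le_succ k) (Ideal.pow_mem_pow h.right_mem _)))

lemma add_left {r : R} (hreg : IsTwoDimRegularLocal R) (hr : r ∈ maximalIdeal R ^ 2) :
    IsParam (x + r) y := by
  refine isParam hreg ?_
  obtain ⟨m, hm, b, rfl⟩ := h.exists_of_mem_pow 1 hr
  rw [pow_one] at hm
  have hu : IsUnit (1 + m) := by
    by_contra hc
    have : (1 : R) ∈ maximalIdeal R := by
      have := sub_mem (show 1 + m ∈ maximalIdeal R from hc) hm
      rwa [add_sub_cancel_right] at this
    exact this isUnit_one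
  rw [show x + (x * m + b * y ^ (1 + 1)) = x * (1 + m) + b * y * y by ring,
    Ideal.span_pair_add_mul_right, Ideal.span_insert, Ideal.span_singleton_mul_right_unit hu,
    ← Ideal.span_insert, h.max_eq]

end IsParam

/-- `f` has order two and its leading form is not divisible by that of `x`. -/
def IsTransverse (x y f : R) : Prop :=
  ∃ u a, IsUnit u ∧ a ∈ maximalIdeal R ∧ f - x * a - u * y ^ 2 ∈ maximalIdeal R ^ 3

namespace IsTransverse

variable {x y f : R}

lemma add_left {r : R} (hf : IsTransverse x y f) (hr : r ∈ maximalIdeal R ^ 2) :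
    IsTransverse (x + r) y f := by
  obtain ⟨u, a, hu, ha, hz⟩ := hf
  refine ⟨u, a, hu, ha, ?_⟩
  have : r * a ∈ maximalIdeal R ^ 3 := by rw [pow_succ]; exact Ideal.mul_mem_mul hr ha
  convert sub_mem hz this using 1
  ring

lemma exists_eq (hf : IsTransverse x y f) (h : IsParam x y) :
    ∃ u a, IsUnit u ∧ f = x * a + u * y ^ 2 := by
  obtain ⟨u, a, hu, ha, hz⟩ := hf
  obtain ⟨m, _, b, hb⟩ := h.exists_of_mem_pow 2 hz
  refine ⟨u + b * y, a + m, ?_, by linear_combination hb⟩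
  by_contra hc
  have := sub_mem (show u + b * y ∈ maximalIdeal R from hc) (Ideal.mul_mem_left _ b h.right_mem)
  rw [add_sub_cancel_right] at this
  exact this hu

lemma of_not_mem (h : IsParam x y) (hf2 : f ∈ maximalIdeal R ^ 2)
    (hf : ∀ a, ∀ z ∈ maximalIdeal R ^ 3, f ≠ x * a + z) : IsTransverse x y f := by
  obtain ⟨m, hm, b, hb⟩ := h.exists_of_mem_pow 1 hf2
  rw [pow_one] at hm
  refine ⟨b, m, ?_, hm, by
    rw [show f - x * m - b * y ^ 2 = 0 by rw [hb]; ring]; exact zero_mem _⟩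
  by_contra hc
  exact hf m _ (by rw [pow_succ']; exact Ideal.mul_mem_mul hc (Ideal.pow_mem_pow h.right_mem 2)) hb

end IsTransverse

lemma length_quotient_le_add (I : Ideal R) (y : R) (hy : ∀ m ∈ maximalIdeal R, m * y ∈ I) :
    Module.length R (R ⧸ I) ≤ 1 + Module.length R (R ⧸ (I ⊔ Ideal.span {y})) := by
  let f : (R ⧸ maximalIdeal R) →ₗ[R] R ⧸ I :=
    Submodule.mapQ _ _ (LinearMap.mulRight R y) (fun m hm => hy m hm)
  rw [Module.length_eq_add_of_exact (LinearMap.range f).subtype (LinearMap.range f).mkQ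
    (Submodule.subtype_injective _) (Submodule.mkQ_surjective _) (LinearMap.exact_subtype_mkQ _)]
  have h1 : Module.length R (R ⧸ maximalIdeal R) = 1 := by
    rw [Module.length_eq_one_iff, isSimpleModule_iff_isCoatom]
    exact (inferInstance : (maximalIdeal R).IsMaximal).out
  gcongr
  · rw [← h1]
    exact Module.length_le_of_surjective f.rangeRestrict f.surjective_rangeRestrict
  · let g : (R ⧸ (I ⊔ Ideal.span {y})) →ₗ[R] ((R ⧸ I) ⧸ LinearMap.range f) :=
      Submodule.liftQ _ ((LinearMap.range f).mkQ ∘ₗ Submodule.mkQ I) (by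
        rw [sup_le_iff]
        refine ⟨fun a ha => ?_, ?_⟩
        · rw [LinearMap.mem_ker, LinearMap.comp_apply, Submodule.mkQ_apply I,
            (Submodule.Quotient.mk_eq_zero I).2 ha, map_zero]
        · rw [Ideal.span_singleton_le_iff_mem]
          simp only [LinearMap.mem_ker, LinearMap.comp_apply, Submodule.mkQ_apply,
            Submodule.Quotient.mk_eq_zero]
          exact ⟨Submodule.Quotient.mk 1, congrArg Submodule.Quotient.mk (one_mul y)⟩)
    refine Module.length_le_of_surjective g ?_
    rw [← LinearMap.range_eq_top, Submodule.range_liftQ, LinearMap.range_eq_top]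
    exact (Submodule.mkQ_surjective _).comp (Submodule.mkQ_surjective _)

lemma length_quotient_transverse_le {x y f : R} (h : IsParam x y) (hf : IsTransverse x y f) :
    Module.length R (R ⧸ Ideal.span {x, f}) ≤ 2 := by
  obtain ⟨u, a, hu, rfl⟩ := hf.exists_eq h
  have h0 : Ideal.span {x, x * a + u * y ^ 2} = Ideal.span {x, y ^ 2} := by
    rw [add_comm, mul_comm x a, Ideal.span_pair_add_mul_left, Ideal.span_insert,
      Ideal.span_singleton_mul_left_unit hu, ← Ideal.span_insert]
  rw [h0]
  refine (length_quotient_le_add _ y fun m hm => ?_).trans ?_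
  · rw [h.max_eq, Ideal.mem_span_pair] at hm
    obtain ⟨p, q, rfl⟩ := hm
    exact Ideal.mem_span_pair.2 ⟨p * y, q, by ring⟩
  · rw [show (2 : ℕ∞) = 1 + 1 from rfl]
    gcongr
    have h1 : Ideal.span {x, y ^ 2} ⊔ Ideal.span {y} = maximalIdeal R := by
      rw [h.max_eq, Ideal.span_insert, sup_assoc, ← Ideal.span_insert, Ideal.span_insert x]
      congr 1
      rw [Ideal.span_insert, sup_eq_right, Ideal.span_singleton_le_span_singleton]
      exact dvd_pow_self _ two_ne_zero
    rw [h1]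
    apply le_of_eq
    rw [Module.length_eq_one_iff, isSimpleModule_iff_isCoatom]
    exact (inferInstance : (maximalIdeal R).IsMaximal).out

omit [IsLocalRing R] in
lemma length_quotient_le_of_mem {J K : Ideal R} {x f : R} (hx : x ∈ J) (hf : f ∈ K) :
    Module.length R (R ⧸ (Ideal.span {x} * K + Ideal.span {f} * J)) ≤
      Module.length R (R ⧸ J) + Module.length R (R ⧸ K) +
        Module.length R (R ⧸ Ideal.span {x, f}) := by
  set Q := Ideal.span {x} * K + Ideal.span {f} * J with hQ
  have hxK : ∀ k ∈ K, k * x ∈ Q := fun k hk =>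
    Ideal.mem_sup_left (mul_comm x k ▸ Ideal.mul_mem_mul (Ideal.mem_span_singleton_self x) hk)
  have hfJ : ∀ k ∈ J, k * f ∈ Q := fun k hk =>
    Ideal.mem_sup_right (mul_comm f k ▸ Ideal.mul_mem_mul (Ideal.mem_span_singleton_self f) hk)
  let p : ((R ⧸ J) × (R ⧸ K)) →ₗ[R] R ⧸ Q :=
    LinearMap.coprod (Submodule.mapQ _ _ (LinearMap.mulRight R f) hfJ)
      (Submodule.mapQ _ _ (LinearMap.mulRight R x) hxK)
  rw [Module.length_eq_add_of_exact (LinearMap.range p).subtype (LinearMap.range p).mkQ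
    (Submodule.subtype_injective _) (Submodule.mkQ_surjective _) (LinearMap.exact_subtype_mkQ _)]
  gcongr
  · rw [← Module.length_prod]
    exact Module.length_le_of_surjective p.rangeRestrict p.surjective_rangeRestrict
  · let g : (R ⧸ Ideal.span {x, f}) →ₗ[R] ((R ⧸ Q) ⧸ LinearMap.range p) :=
      Submodule.liftQ _ ((LinearMap.range p).mkQ ∘ₗ Submodule.mkQ Q) (by
        rw [Ideal.span_le]
        rintro z (rfl | rfl) <;>
          simp only [SetLike.mem_coe, LinearMap.mem_ker, LinearMap.comp_apply, Submodule.mkQ_apply,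
            Submodule.Quotient.mk_eq_zero]
        · exact ⟨(0, Submodule.Quotient.mk 1), by
            rw [LinearMap.coprod_apply, map_zero, zero_add]
            exact congrArg Submodule.Quotient.mk (one_mul _)⟩
        · exact ⟨(Submodule.Quotient.mk 1, 0), by
            rw [LinearMap.coprod_apply, map_zero, add_zero]
            exact congrArg Submodule.Quotient.mk (one_mul _)⟩)
    refine Module.length_le_of_surjective g ?_
    rw [← LinearMap.range_eq_top, Submodule.range_liftQ, LinearMap.range_eq_top]
    exact (Submodule.mkQ_surjective _).comp (Submodule.mkQ_surjective _)

lemma isFiniteLength_quotient_of_pow_le [IsNoetherianRing R] {I : Ideal R} {n : ℕ}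
    (hI : maximalIdeal R ^ n ≤ I) : IsFiniteLength R (R ⧸ I) := by
  by_cases hn : I = ⊤
  · subst hn
    exact .of_subsingleton
  have : Nontrivial (R ⧸ I) := Ideal.Quotient.nontrivial_iff.2 hn
  have : IsLocalRing (R ⧸ I) := .of_surjective' _ Ideal.Quotient.mk_surjective
  have hart : IsArtinianRing (R ⧸ I) := by
    rw [isArtinianRing_iff_isNilpotent_maximalIdeal]
    refine ⟨n, ?_⟩
    rw [← map_maximalIdeal_of_surjective _ Ideal.Quotient.mk_surjective, ← Ideal.map_pow]
    exact (Ideal.map_eq_bot_iff_le_ker _).2 (by rwa [Ideal.mk_ker])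
  rw [isFiniteLength_iff_isNoetherian_isArtinian]
  exact ⟨inferInstance, isArtinian_of_surjective_algebraMap (Ideal.Quotient.mk_surjective (I := I))⟩

omit [IsLocalRing R] in
lemma le_of_length_le {Q I : Ideal R} (hle : Q ≤ I) (hI : IsFiniteLength R (R ⧸ I))
    (hlen : Module.length R (R ⧸ Q) ≤ Module.length R (R ⧸ I)) : I ≤ Q := by
  have hsurj := Submodule.factor_surjective hle
  have he := Module.length_eq_add_of_exact (LinearMap.ker (Submodule.factor hle)).subtype
    (Submodule.factor hle) (Submodule.subtype_injective _) hsurj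
    (LinearMap.exact_subtype_ker_map _)
  rw [he] at hlen
  rw [← Module.length_ne_top_iff] at hI
  have h0 : Module.length R (LinearMap.ker (Submodule.factor hle)) = 0 := by
    lift Module.length R (R ⧸ I) to ℕ using hI with b
    generalize Module.length R (LinearMap.ker (Submodule.factor hle)) = a at hlen ⊢
    have ha : a ≠ ⊤ := by rintro rfl; simp at hlen
    lift a to ℕ using ha
    norm_cast at hlen ⊢
    omega
  rw [Module.length_eq_zero_iff, Submodule.subsingleton_iff_eq_bot] at h0
  intro z hz
  have : (Submodule.Quotient.mk z : R ⧸ Q) ∈ LinearMap.ker (Submodule.factor hle) := by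
    rw [LinearMap.mem_ker]
    simpa using (Submodule.Quotient.mk_eq_zero I).2 hz
  rw [h0, Submodule.mem_bot, Submodule.Quotient.mk_eq_zero] at this
  exact this

end Param

section Ideals

variable {R : Type*} [CommRing R] [IsLocalRing R]

lemma exists_pow_le_of_isMPrimary [IsNoetherianRing R] {I : Ideal R} (hI : IsMPrimary I) :
    ∃ n, maximalIdeal R ^ n ≤ I := by
  rw [← (show I.radical = maximalIdeal R from hI)]
  exact Ideal.exists_radical_pow_le_of_fg I (IsNoetherian.noetherian _)

lemma exists_pow_le_mul [IsNoetherianRing R] {J K : Ideal R} (hJ : IsMPrimary J)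
    (hK : IsMPrimary K) : ∃ n, maximalIdeal R ^ n ≤ J * K := by
  obtain ⟨a, ha⟩ := exists_pow_le_of_isMPrimary hJ
  obtain ⟨b, hb⟩ := exists_pow_le_of_isMPrimary hK
  exact ⟨a + b, by rw [pow_add]; exact Ideal.mul_mono ha hb⟩

lemma mul_le_of_transverse [IsNoetherianRing R] {J K : Ideal R} (hJ : IsMPrimary J)
    (hK : IsMPrimary K)
    (hlen : modLength R (R ⧸ (J * K)) =
      modLength R (R ⧸ J) + modLength R (R ⧸ K) + ((2 : ℕ) : WithBot ℕ∞))
    {x y f : R} (h : IsParam x y) (hf : IsTransverse x y f) (hx : x ∈ J) (hfK : f ∈ K) :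
    J * K ≤ Ideal.span {x} * K + Ideal.span {f} * J := by
  obtain ⟨n, hn⟩ := exists_pow_le_mul hJ hK
  refine le_of_length_le ?_ (isFiniteLength_quotient_of_pow_le hn) ?_
  · rw [Submodule.add_eq_sup, sup_le_iff, mul_comm J K]
    constructor
    · rw [mul_comm K J]
      exact Ideal.mul_mono_left ((Ideal.span_singleton_le_iff_mem _).2 hx)
    · exact Ideal.mul_mono_left ((Ideal.span_singleton_le_iff_mem _).2 hfK)
  · simp only [modLength, ← Module.coe_length] at hlen
    have h1 : Module.length R (R ⧸ (J * K)) =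
        Module.length R (R ⧸ J) + Module.length R (R ⧸ K) + 2 := by
      refine WithBot.coe_injective (hlen.trans ?_)
      push_cast
      rfl
    rw [h1]
    refine (length_quotient_le_of_mem hx hfK).trans ?_
    gcongr
    exact length_quotient_transverse_le h hf

lemma mem_of_mul_mem_of_transverse [IsNoetherianRing R] [IsDomain R] {J K : Ideal R}
    (hJ : IsMPrimary J) (hK : IsMPrimary K)
    (hlen : modLength R (R ⧸ (J * K)) =
      modLength R (R ⧸ J) + modLength R (R ⧸ K) + ((2 : ℕ) : WithBot ℕ∞))
    {x y f s : R} (h : IsParam x y) (hx0 : x ≠ 0) (hf : IsTransverse x y f) (hx : x ∈ J)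
    (hfK : f ∈ K) (hs : x * s ∈ J * K) : s ∈ K := by
  have := mul_le_of_transverse hJ hK hlen h hf hx hfK hs
  obtain ⟨_, ha, _, hb, hab⟩ := Submodule.mem_sup.1 this
  obtain ⟨k, hk, rfl⟩ := Ideal.mem_span_singleton_mul.1 ha
  obtain ⟨l, hl, rfl⟩ := Ideal.mem_span_singleton_mul.1 hb
  have h1 : f * l ∈ Ideal.span {x} := Ideal.mem_span_singleton.2 ⟨s - k, by linear_combination hab⟩
  have h2 : f ∉ Ideal.span {x} := by
    intro hc
    obtain ⟨u, a, hu, rfl⟩ := hf.exists_eq h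
    obtain ⟨c, hc⟩ := Ideal.mem_span_singleton.1 hc
    exact h.unit_mul_pow_ne (i := 2) (a := c - a) (z := 0) hu (zero_mem _) (by linear_combination hc)
  obtain ⟨c, rfl⟩ := Ideal.mem_span_singleton.1 ((h.prime.mem_or_mem h1).resolve_left h2)
  have : s = k + f * c := mul_left_cancel₀ hx0 (by linear_combination -hab)
  rw [this]
  exact add_mem hk (Ideal.mul_mem_right _ _ hfK)

lemma exists_isParam_left (hreg : IsTwoDimRegularLocal R) {x : R} (hx : x ∈ maximalIdeal R)
    (hx2 : x ∉ maximalIdeal R ^ 2) : ∃ y, IsParam x y := by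
  obtain ⟨s, t, hst⟩ := hreg.2.2
  have hx' := hx
  rw [hst, Ideal.mem_span_pair] at hx'
  obtain ⟨p, q, rfl⟩ := hx'
  by_cases hp : IsUnit p
  · refine ⟨t, isParam hreg ?_⟩
    rw [Ideal.span_pair_add_mul_right, Ideal.span_insert, Ideal.span_singleton_mul_left_unit hp,
      ← Ideal.span_insert, hst]
  by_cases hq : IsUnit q
  · refine ⟨s, isParam hreg ?_⟩
    rw [add_comm, Ideal.span_pair_add_mul_right, Ideal.span_insert,
      Ideal.span_singleton_mul_left_unit hq, ← Ideal.span_insert, hst, Ideal.span_pair_comm]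
  · refine absurd ?_ hx2
    rw [pow_two]
    exact add_mem (Ideal.mul_mem_mul hp (hst ▸ Ideal.subset_span (by simp)))
      (Ideal.mul_mem_mul hq (hst ▸ Ideal.subset_span (by simp)))

lemma exists_transverse (hreg : IsTwoDimRegularLocal R) {f : R} (hf2 : f ∈ maximalIdeal R ^ 2)
    (hf3 : f ∉ maximalIdeal R ^ 3) : ∃ x y, IsParam x y ∧ IsTransverse x y f := by
  obtain ⟨s, t, hst⟩ := hreg.2.2
  have h := isParam hreg hst
  obtain ⟨m, hm, b, hb⟩ := h.exists_of_mem_pow 1 hf2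
  rw [pow_one] at hm
  have hm' := hm
  rw [hst, Ideal.mem_span_pair] at hm'
  obtain ⟨p, q, rfl⟩ := hm'
  have hs3 : ∀ c ∈ maximalIdeal R, ∀ a ∈ maximalIdeal R, ∀ b ∈ maximalIdeal R,
      c * (a * b) ∈ maximalIdeal R ^ 3 := fun c hc a ha b hb => by
    rw [pow_succ', pow_two]; exact Ideal.mul_mem_mul hc (Ideal.mul_mem_mul ha hb)
  by_cases hbu : IsUnit b
  · refine ⟨s, t, h, b, _, hbu, hm, ?_⟩
    rw [hb]
    convert zero_mem (maximalIdeal R ^ 3) using 1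
    ring
  by_cases hpu : IsUnit p
  · refine ⟨t, s, isParam hreg (by rw [hst, Ideal.span_pair_comm]), p, q * s + b * t, hpu,
      add_mem (Ideal.mul_mem_left _ _ h.left_mem) (Ideal.mul_mem_left _ _ h.right_mem), ?_⟩
    rw [hb]
    convert zero_mem (maximalIdeal R ^ 3) using 1
    ring
  have hqu : IsUnit q := by
    by_contra hqu
    apply hf3
    rw [hb]
    convert add_mem (add_mem (hs3 p hpu s h.left_mem s h.left_mem)
      (hs3 q hqu s h.left_mem t h.right_mem)) (hs3 b hbu t h.right_mem t h.right_mem) using 1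
    ring
  refine ⟨s - t, t, isParam hreg ?_, q, q * t, hqu, Ideal.mul_mem_left _ _ h.right_mem, ?_⟩
  · rw [hst, show s - t = s + (-1) * t by ring, Ideal.span_pair_add_mul_right]
  · rw [hb]
    convert add_mem (hs3 p hpu s h.left_mem s h.left_mem)
      (hs3 b hbu t h.right_mem t h.right_mem) using 1
    ring

lemma exists_generators (hreg : IsTwoDimRegularLocal R) {J K : Ideal R}
    (hJ : IsMPrimary J) (hJo : ordEQ J 1) (hKo : ordEQ K 2)
    (hmk : maximalIdeal R ^ 2 = J * maximalIdeal R + K) :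
    ∃ x y f n, IsParam x y ∧ IsTransverse x y f ∧ f ∈ K ∧ 1 ≤ n ∧ J = Ideal.span {x, y ^ n} := by
  have := hreg.1
  by_cases hJm : J = maximalIdeal R
  · obtain ⟨f, hf, hf3⟩ := Set.not_subset.1 hKo.2
    obtain ⟨x, y, h, ht⟩ := exists_transverse hreg (hKo.1 hf) hf3
    exact ⟨x, y, f, 1, h, ht, hf, le_rfl, by rw [hJm, pow_one, h.max_eq]⟩
  obtain ⟨x, hx, hx2⟩ := Set.not_subset.1 hJo.2
  have hJle : J ≤ maximalIdeal R := by simpa using hJo.1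
  obtain ⟨y, h⟩ := exists_isParam_left hreg (hJle hx) hx2
  have hex : ∃ n, y ^ n ∈ J := by
    obtain ⟨N, hN⟩ := exists_pow_le_of_isMPrimary hJ
    exact ⟨N, hN (Ideal.pow_mem_pow h.right_mem N)⟩
  classical
  obtain ⟨n, hn, hmin⟩ : ∃ n, y ^ n ∈ J ∧ ∀ i < n, y ^ i ∉ J :=
    ⟨Nat.find hex, Nat.find_spec hex, fun i hi => Nat.find_min hex hi⟩
  have hJeq : J = Ideal.span {x, y ^ n} := by
    apply le_antisymm
    · intro a ha
      rcases exists_form_or h.max_eq a n with ⟨i, hi, u, r, hu, rfl⟩ | ⟨r, s, rfl⟩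
      · refine absurd ?_ (hmin i hi)
        rw [← Ideal.unit_mul_mem_iff_mem J hu]
        exact (Ideal.add_mem_iff_right _ (Ideal.mul_mem_right _ _ hx)).1 ha
      · exact Ideal.mem_span_pair.2 ⟨r, s, by ring⟩
    · rw [Ideal.span_le]
      rintro z (rfl | rfl)
      exacts [hx, hn]
  have hn0 : n ≠ 0 := by
    rintro rfl
    exact hJle hn (by simp)
  have hn1 : n ≠ 1 := by
    rintro rfl
    exact hJm (by rw [hJeq, pow_one, h.max_eq])
  have hy2 : y ^ 2 ∈ J * maximalIdeal R + K := hmk ▸ Ideal.pow_mem_pow h.right_mem 2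
  obtain ⟨j, hj, f, hf, hjf⟩ := Submodule.mem_sup.1 hy2
  have hj' : ∃ a, ∃ z ∈ maximalIdeal R ^ 3, j = x * a + z := by
    refine Submodule.mul_induction_on hj (fun a ha b hb => ?_) ?_
    · rw [hJeq, Ideal.mem_span_pair] at ha
      obtain ⟨p, q, rfl⟩ := ha
      refine ⟨p * b, q * y ^ n * b, ?_, by ring⟩
      rw [pow_succ]
      exact Ideal.mul_mem_mul (Ideal.mul_mem_left _ _
        (Ideal.pow_le_pow_right (by omega) (Ideal.pow_mem_pow h.right_mem n))) hb
    · rintro _ _ ⟨a, z, hz, rfl⟩ ⟨a', z', hz', rfl⟩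
      exact ⟨a + a', z + z', add_mem hz hz', by ring⟩
  obtain ⟨a, z, hz, rfl⟩ := hj'
  refine ⟨x, y, f, n, h, .of_not_mem h (hKo.1 hf) fun a' z' hz' he => ?_, hf, by omega, hJeq⟩
  exact h.unit_mul_pow_ne (i := 2) (u := 1) (a := a + a') isUnit_one (add_mem hz hz')
    (by linear_combination he - hjf)

end Ideals

section Det

variable {R : Type*} [CommRing R]

/-- The determinant of the matrix with columns `a`, `b`, `c`, as a linear function of `c`. -/
def det3 (a b : Fin 3 → R) : (Fin 3 → R) →ₗ[R] R where
  toFun c := a 0 * (b 1 * c 2 - b 2 * c 1) - a 1 * (b 0 * c 2 - b 2 * c 0) +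
    a 2 * (b 0 * c 1 - b 1 * c 0)
  map_add' c d := by simp only [Pi.add_apply]; ring
  map_smul' r c := by simp only [Pi.smul_apply, smul_eq_mul, RingHom.id_apply]; ring

lemma det3_apply (a b c : Fin 3 → R) : det3 a b c =
    a 0 * (b 1 * c 2 - b 2 * c 1) - a 1 * (b 0 * c 2 - b 2 * c 0) +
      a 2 * (b 0 * c 1 - b 1 * c 0) := rfl

lemma det3_rotate (a b c : Fin 3 → R) : det3 a b c = det3 b c a := by
  simp only [det3_apply]; ring

lemma colDet_eq_det3 (w : Fin 3 → Fin 3 → R) : colDet w = det3 (w 0) (w 1) (w 2) := by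
  simp only [colDet, Matrix.det_fin_three, Matrix.of_apply, det3_apply]; ring

lemma det3_mem_mul {I I' : Ideal R} {a b c : Fin 3 → R} (hb : ∀ i, b i ∈ I)
    (hc : ∀ i, c i ∈ I') : det3 a b c ∈ I * I' := by
  have h (i j) : b i * c j ∈ I * I' := Ideal.mul_mem_mul (hb i) (hc j)
  rw [det3_apply]
  exact add_mem (sub_mem (Ideal.mul_mem_left _ _ (sub_mem (h _ _) (h _ _)))
    (Ideal.mul_mem_left _ _ (sub_mem (h _ _) (h _ _))))
    (Ideal.mul_mem_left _ _ (sub_mem (h _ _) (h _ _)))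

lemma det3_mem {I : Ideal R} {a b c : Fin 3 → R} (hc : ∀ i, c i ∈ I) : det3 a b c ∈ I := by
  rw [← Ideal.top_mul I]
  exact det3_mem_mul (fun _ => trivial) hc

lemma det3_mul_eq (a b c g : Fin 3 → R) :
    det3 a b c • g = det3 b c g • a + det3 c a g • b + det3 a b g • c := by
  funext i
  simp only [det3_apply, Pi.add_apply, Pi.smul_apply, smul_eq_mul]
  fin_cases i <;> simp only [Fin.zero_eta, Fin.mk_one, Fin.reduceFinMk] <;> ring

lemma exists_coeff_of_isUnit_det3 {a b c g : Fin 3 → R} {I : Ideal R} (h : IsUnit (det3 a b c))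
    (hg : ∀ i, g i ∈ I) :
    ∃ p ∈ I, ∃ q ∈ I, ∃ r ∈ I, g = p • a + q • b + r • c := by
  obtain ⟨u, hu⟩ := h.exists_left_inv
  refine ⟨u * det3 b c g, Ideal.mul_mem_left _ _ (det3_mem hg), u * det3 c a g,
    Ideal.mul_mem_left _ _ (det3_mem hg), u * det3 a b g,
    Ideal.mul_mem_left _ _ (det3_mem hg), ?_⟩
  rw [mul_smul, mul_smul, mul_smul, ← smul_add, ← smul_add, ← det3_mul_eq, smul_smul, hu, one_smul]

lemma det3_expand (x y : R) (g₁ g₂ g₃ t₁ t₂ t₃ : Fin 3 → R) :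
    det3 (y • g₁ + x • t₁) (y • g₂ + x • t₂) (y • g₃ + x • t₃) =
      y ^ 3 * det3 g₁ g₂ g₃ +
      x * y ^ 2 * (det3 g₁ g₂ t₃ + det3 g₂ g₃ t₁ + det3 g₃ g₁ t₂) +
      x ^ 2 * (y * (det3 g₁ t₂ t₃ + det3 g₂ t₃ t₁ + det3 g₃ t₁ t₂) + x * det3 t₁ t₂ t₃) := by
  simp only [det3_apply, Pi.add_apply, Pi.smul_apply, smul_eq_mul]
  ring

lemma det3_expand_left (x y : R) (g₁ g₂ t₁ t₂ w : Fin 3 → R) :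
    det3 (y • g₁ + x • t₁) (y • g₂ + x • t₂) w =
      y ^ 2 * det3 g₁ g₂ w + x * (y * (det3 g₁ t₂ w + det3 t₁ g₂ w) + x * det3 t₁ t₂ w) := by
  simp only [det3_apply, Pi.add_apply, Pi.smul_apply, smul_eq_mul]
  ring

lemma det3_smul_add (a : Fin 3 → R) (p q x : R) (e s t : Fin 3 → R) :
    det3 a (p • e + x • s) (q • e + x • t) =
      x * (p * det3 a e t + q * det3 a s e) + x ^ 2 * det3 a s t := by
  simp only [det3_apply, Pi.add_apply, Pi.smul_apply, smul_eq_mul]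
  ring

lemma det3_mem_of_decomposition {I : Ideal R} {M : Submodule R (Fin 3 → R)} {v₁ v₂ : Fin 3 → R}
    {S : Set (Fin 3 → R)} (hv₁ : v₁ ∈ M) (hv₂ : v₂ ∈ M) (hS : ∀ s ∈ S, s ∈ M)
    (hdec : ∀ w ∈ M, ∃ a b : R, ∃ s ∈ S, w = a • v₁ + b • v₂ + s)
    (h₁ : ∀ s ∈ S, det3 v₁ v₂ s ∈ I)
    (h₂ : ∀ w ∈ M, ∀ s ∈ S, ∀ t ∈ S, det3 w s t ∈ I) {w₁ w₂ w₃ : Fin 3 → R}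
    (hw₁ : w₁ ∈ M) (hw₂ : w₂ ∈ M) (hw₃ : w₃ ∈ M) : det3 w₁ w₂ w₃ ∈ I := by
  obtain ⟨a₁, b₁, s₁, hs₁, rfl⟩ := hdec _ hw₁
  obtain ⟨a₂, b₂, s₂, hs₂, rfl⟩ := hdec _ hw₂
  obtain ⟨a₃, b₃, s₃, hs₃, rfl⟩ := hdec _ hw₃
  have hu (a b : R) : a • v₁ + b • v₂ ∈ M := add_mem (M.smul_mem _ hv₁) (M.smul_mem _ hv₂)
  have key : det3 (a₁ • v₁ + b₁ • v₂ + s₁) (a₂ • v₁ + b₂ • v₂ + s₂) (a₃ • v₁ + b₃ • v₂ + s₃) =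
      ((a₁ * b₂ - a₂ * b₁) * det3 v₁ v₂ s₃ + (a₂ * b₃ - a₃ * b₂) * det3 v₁ v₂ s₁ +
        (a₃ * b₁ - a₁ * b₃) * det3 v₁ v₂ s₂) +
      (det3 (a₁ • v₁ + b₁ • v₂) s₂ s₃ + det3 (a₂ • v₁ + b₂ • v₂) s₃ s₁ +
        det3 (a₃ • v₁ + b₃ • v₂) s₁ s₂ + det3 s₁ s₂ s₃) := by
    simp only [det3_apply, Pi.add_apply, Pi.smul_apply, smul_eq_mul]
    ring
  rw [key]
  refine add_mem (add_mem (add_mem ?_ ?_) ?_) (add_mem (add_mem (add_mem ?_ ?_) ?_) ?_)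
  · exact Ideal.mul_mem_left _ _ (h₁ _ hs₃)
  · exact Ideal.mul_mem_left _ _ (h₁ _ hs₁)
  · exact Ideal.mul_mem_left _ _ (h₁ _ hs₂)
  · exact h₂ _ (hu _ _) _ hs₂ _ hs₃
  · exact h₂ _ (hu _ _) _ hs₃ _ hs₁
  · exact h₂ _ (hu _ _) _ hs₁ _ hs₂
  · exact h₂ _ (hS _ hs₁) _ hs₂ _ hs₃

lemma det3_mem_maxMinors {M : Submodule R (Fin 3 → R)} {a b c : Fin 3 → R} (ha : a ∈ M)
    (hb : b ∈ M) (hc : c ∈ M) : det3 a b c ∈ maxMinors M := by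
  refine Ideal.subset_span ⟨![a, b, c], fun j => ?_, by rw [colDet_eq_det3]; rfl⟩
  fin_cases j
  exacts [ha, hb, hc]

lemma maxMinors_le {M : Submodule R (Fin 3 → R)} {I : Ideal R}
    (h : ∀ a ∈ M, ∀ b ∈ M, ∀ c ∈ M, det3 a b c ∈ I) : maxMinors M ≤ I := by
  refine Ideal.span_le.2 ?_
  rintro _ ⟨w, hw, rfl⟩
  rw [colDet_eq_det3]
  exact h _ (hw 0) _ (hw 1) _ (hw 2)

lemma MemIntClosure.of_mem {I : Ideal R} {z : R} (hz : z ∈ I) : MemIntClosure I z := by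
  refine ⟨1, one_pos, fun _ => -z, fun i hi => ?_, by simp⟩
  rw [Finset.Icc_self, Finset.mem_singleton] at hi
  rw [hi, pow_one]
  exact neg_mem hz

namespace ModIntClosed

variable {M : Submodule R (Fin 3 → R)} (hM : ModIntClosed M)
include hM

lemma mem_of_det3_mem {v : Fin 3 → R} (hv : ∀ w ∈ M, ∀ w' ∈ M, det3 w w' v ∈ maxMinors M) :
    v ∈ M := by
  refine hM v fun w j hj hw => .of_mem ?_
  subst hj
  rw [colDet_eq_det3]
  fin_cases j
  · rw [det3_rotate]
    exact hv _ (hw 1 (by decide)) _ (hw 2 (by decide))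
  · rw [← det3_rotate]
    exact hv _ (hw 2 (by decide)) _ (hw 0 (by decide))
  · exact hv _ (hw 0 (by decide)) _ (hw 1 (by decide))

lemma mem_of_forall_mem {v : Fin 3 → R} (hv : ∀ i, v i ∈ maxMinors M) : v ∈ M :=
  hM.mem_of_det3_mem fun _ _ _ _ => det3_mem hv

lemma smul_mem_of_smul_mem {J K : Ideal R} {x : R} (hJK : maxMinors M = J * K)
    (hx : ∀ s, x * s ∈ J * K → s ∈ K) {e : Fin 3 → R} (he : x • e ∈ M) {j : R} (hj : j ∈ J) :
    j • e ∈ M := by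
  refine hM.mem_of_det3_mem fun w hw w' hw' => ?_
  rw [map_smul, smul_eq_mul, hJK]
  refine Ideal.mul_mem_mul hj (hx _ ?_)
  rw [← hJK, ← smul_eq_mul, ← map_smul]
  exact det3_mem_maxMinors hw hw' he

end ModIntClosed

lemma mem_maximalIdeal_of_not_hasFreeSummand [IsLocalRing R] [IsDomain R]
    {M : Submodule R (Fin 3 → R)} (hM : ¬ HasFreeSummand M) {w : Fin 3 → R} (hw : w ∈ M)
    (i : Fin 3) : w i ∈ maximalIdeal R := by
  by_contra hc
  have hu : IsUnit (w i) := not_not.1 hc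
  obtain ⟨u, hu'⟩ := hu.exists_left_inv
  have hw0 : w ≠ 0 := by
    rintro rfl
    exact hu.ne_zero rfl
  refine hM ⟨R ∙ w, M ⊓ LinearMap.ker (LinearMap.proj i), le_antisymm ?_ ?_, ?_, ?_, ?_⟩
  · exact sup_le ((Submodule.span_singleton_le_iff_mem _ _).2 hw) inf_le_left
  · intro v hv
    rw [← add_sub_cancel ((v i * u) • w) v]
    refine add_mem (Submodule.mem_sup_left (Submodule.mem_span_singleton.2 ⟨_, rfl⟩))
      (Submodule.mem_sup_right ⟨sub_mem hv (M.smul_mem _ hw), ?_⟩)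
    simp [mul_assoc, hu']
  · rw [eq_bot_iff]
    rintro v ⟨hv, -, hv'⟩
    obtain ⟨c, rfl⟩ := Submodule.mem_span_singleton.1 hv
    have : c * w i = 0 := by simpa using hv'
    rw [(mul_eq_zero.1 this).resolve_right hu.ne_zero, zero_smul]
    exact zero_mem _
  · rwa [Ne, Submodule.span_singleton_eq_bot]
  · exact Module.Free.of_equiv (LinearEquiv.toSpanNonzeroSingleton R _ w hw0)

end Det

section Decomposition

variable {R : Type*} [CommRing R] [IsLocalRing R]

lemma IsParam.exists_smul_add {x y : R} (h : IsParam x y) {w : Fin 3 → R}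
    (hw : ∀ i, w i ∈ maximalIdeal R) : ∃ g t : Fin 3 → R, w = y • g + x • t := by
  have (i : Fin 3) : ∃ a b, a * x + b * y = w i := by
    rw [← Ideal.mem_span_pair, ← h.max_eq]
    exact hw i
  choose t g hgt using this
  exact ⟨g, t, funext fun i => by simp [← hgt i]; ring⟩

lemma IsTransverse.left_mul_not_mem [IsDomain R] {x y f : R} (h : IsParam x y) (hx : x ≠ 0)
    (hf : IsTransverse x y f) : x * f ∉ Ideal.span {x ^ 2} ⊔ maximalIdeal R ^ 4 := by
  intro hc
  obtain ⟨_, hp, z, hz, hpz⟩ := Submodule.mem_sup.1 hc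
  obtain ⟨p, rfl⟩ := Ideal.mem_span_singleton.1 hp
  obtain ⟨u, a, hu, -, hz'⟩ := hf
  have h3 : f - x * p ∈ maximalIdeal R ^ 3 := by
    refine h.mem_pow_of_mul_mem hx ?_
    convert hz using 1
    linear_combination -hpz
  exact h.unit_mul_pow_ne (i := 2) (a := p - a) hu (sub_mem h3 hz') (by ring)

lemma IsTransverse.right_mul_not_mem {x y f : R} (h : IsParam x y)
    (hf : IsTransverse x y f) : y * f ∉ Ideal.span {x} ⊔ maximalIdeal R ^ 4 := by
  intro hc
  obtain ⟨_, hp, z, hz, hpz⟩ := Submodule.mem_sup.1 hc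
  obtain ⟨p, rfl⟩ := Ideal.mem_span_singleton.1 hp
  obtain ⟨u, a, hu, rfl⟩ := hf.exists_eq h
  exact h.unit_mul_pow_ne (i := 3) (a := p - y * a) hu hz (by linear_combination -hpz)

lemma decomposableSub_of_smul_mem [IsDomain R] {M : Submodule R (Fin 3 → R)} {J : Ideal R}
    {x y : R} {n : ℕ} {e₁ e₂ t₁ t₂ e : Fin 3 → R} (h : IsParam x y) (hx : x ≠ 0)
    (hJ : J = Ideal.span {x, y ^ n}) (hI : maxMinors M ≤ Ideal.span {x, y ^ (2 + n)})
    (hI0 : maxMinors M ≠ ⊥) (hv₁ : y • e₁ + x • t₁ ∈ M) (hv₂ : y • e₂ + x • t₂ ∈ M)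
    (hd : IsUnit (det3 e₁ e₂ e)) (he : ∀ j ∈ J, j • e ∈ M) : DecomposableSub M := by
  obtain ⟨u, hu⟩ := hd.exists_left_inv
  have hφ : ∀ w ∈ M, det3 e₁ e₂ w ∈ J := by
    intro w hw
    rw [hJ]
    refine h.mem_of_pow_mul_mem (i := 2) ?_
    have := hI (det3_mem_maxMinors hv₁ hv₂ hw)
    rw [det3_expand_left] at this
    exact (Ideal.add_mem_iff_left _ (Ideal.mul_mem_right _ _ (Ideal.subset_span (by simp)))).1 this
  refine ⟨Submodule.map (LinearMap.toSpanSingleton R (Fin 3 → R) e) J, M ⊓ LinearMap.ker (det3 e₁ e₂),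
    le_antisymm (sup_le ?_ inf_le_left) ?_, ?_, ?_, ?_⟩
  · rintro _ ⟨j, hj, rfl⟩
    exact he j hj
  · intro w hw
    have hj : det3 e₁ e₂ w * u ∈ J := Ideal.mul_mem_right _ _ (hφ w hw)
    rw [← add_sub_cancel ((det3 e₁ e₂ w * u) • e) w]
    refine add_mem (Submodule.mem_sup_left ⟨_, hj, rfl⟩)
      (Submodule.mem_sup_right ⟨sub_mem hw (he _ hj), ?_⟩)
    rw [SetLike.mem_coe, LinearMap.mem_ker, map_sub, map_smul, smul_eq_mul, mul_assoc, hu, mul_one,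
      sub_self]
  · rw [eq_bot_iff]
    rintro _ ⟨⟨j, -, rfl⟩, -, hj⟩
    rw [SetLike.mem_coe, LinearMap.mem_ker, LinearMap.toSpanSingleton_apply, map_smul,
      smul_eq_mul] at hj
    rw [(mul_eq_zero.1 hj).resolve_right hd.ne_zero, map_zero]
    exact zero_mem _
  · intro hc
    have hxe : x • e ∈ Submodule.map (LinearMap.toSpanSingleton R (Fin 3 → R) e) J :=
      ⟨x, by rw [hJ]; exact Ideal.subset_span (by simp), rfl⟩
    rw [hc, Submodule.mem_bot] at hxe
    have := congrArg (det3 e₁ e₂) hxe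
    rw [map_smul, map_zero, smul_eq_mul] at this
    exact (mul_ne_zero hx hd.ne_zero) this
  · intro hc
    have hdec : ∀ w ∈ M, w = (det3 e₁ e₂ w * u) • e := by
      intro w hw
      have : w - (det3 e₁ e₂ w * u) • e ∈ M ⊓ LinearMap.ker (det3 e₁ e₂) := by
        refine ⟨sub_mem hw (he _ (Ideal.mul_mem_right _ _ (hφ w hw))), ?_⟩
        rw [SetLike.mem_coe, LinearMap.mem_ker, map_sub, map_smul, smul_eq_mul, mul_assoc, hu,
          mul_one, sub_self]
      rw [hc, Submodule.mem_bot] at this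
      exact sub_eq_zero.1 this
    refine hI0 (eq_bot_iff.2 (maxMinors_le fun a ha b hb c _ => ?_))
    rw [hdec a ha, hdec b hb, Submodule.mem_bot]
    simp only [det3_apply, Pi.smul_apply, smul_eq_mul]
    ring

lemma exists_pair_mem [IsDomain R] {M : Submodule R (Fin 3 → R)} {x y f : R} (h : IsParam x y)
    (hx : x ≠ 0) (hf : IsTransverse x y f) (hM : ∀ w ∈ M, ∀ i, w i ∈ maximalIdeal R)
    (hxf : x * f ∈ maxMinors M) :
    ∃ e₁ e₂ e₃ t₁ t₂ : Fin 3 → R, y • e₁ + x • t₁ ∈ M ∧ y • e₂ + x • t₂ ∈ M ∧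
      IsUnit (det3 e₁ e₂ e₃) := by
  by_contra! hc
  have hc' : ∀ e₁ e₂ e₃ t₁ t₂ : Fin 3 → R, y • e₁ + x • t₁ ∈ M → y • e₂ + x • t₂ ∈ M →
      det3 e₁ e₂ e₃ ∈ maximalIdeal R := hc
  refine hf.left_mul_not_mem h hx (maxMinors_le (fun a ha b hb c hw => ?_) hxf)
  obtain ⟨g₁, t₁, rfl⟩ := h.exists_smul_add (hM a ha)
  obtain ⟨g₂, t₂, rfl⟩ := h.exists_smul_add (hM b hb)
  obtain ⟨g₃, t₃, rfl⟩ := h.exists_smul_add (hM c hw)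
  rw [det3_expand]
  have hy := Ideal.pow_mem_pow h.right_mem
  refine add_mem (Submodule.mem_sup_right (add_mem ?_ ?_))
    (Submodule.mem_sup_left (Ideal.mul_mem_right _ _ (Ideal.mem_span_singleton_self _)))
  · rw [pow_succ]
    exact Ideal.mul_mem_mul (hy 3) (hc' _ _ _ _ _ ha hb)
  · rw [show 4 = (1 + 2) + 1 from rfl, pow_succ, pow_add, pow_one]
    exact Ideal.mul_mem_mul (Ideal.mul_mem_mul h.left_mem (hy 2))
      (add_mem (add_mem (hc' _ _ _ _ _ ha hb) (hc' _ _ _ _ _ hb hw)) (hc' _ _ _ _ _ hw ha))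

/-- If `M` contains `y eᵢ + x tᵢ` for `i = 1, 2`, where `e₁, e₂, e₃` is a basis, then every
element of `M` is, modulo these two, of the form `c yⁿ e₃ + x t`. -/
lemma exists_decomposition {M : Submodule R (Fin 3 → R)} {x y : R} {n : ℕ} (hn : 1 ≤ n)
    {e₁ e₂ e₃ t₁ t₂ : Fin 3 → R} (h : IsParam x y)
    (hM : ∀ w ∈ M, ∀ i, w i ∈ maximalIdeal R) (hI : maxMinors M ≤ Ideal.span {x, y ^ (2 + n)})
    (hv₁ : y • e₁ + x • t₁ ∈ M) (hv₂ : y • e₂ + x • t₂ ∈ M) (hd : IsUnit (det3 e₁ e₂ e₃))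
    {w : Fin 3 → R} (hw : w ∈ M) :
    ∃ a b : R, ∃ s ∈ {s | s ∈ M ∧ ∃ (c : R) (t : Fin 3 → R), s = (c * y ^ n) • e₃ + x • t},
      w = a • (y • e₁ + x • t₁) + b • (y • e₂ + x • t₂) + s := by
  obtain ⟨g, t, rfl⟩ := h.exists_smul_add (hM w hw)
  obtain ⟨a, -, b, -, c, -, rfl⟩ := exists_coeff_of_isUnit_det3 (I := ⊤) (g := g) hd
    (fun _ => trivial)
  refine ⟨a, b, _, ⟨sub_mem hw (add_mem (M.smul_mem a hv₁) (M.smul_mem b hv₂)), ?_⟩,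
    (add_sub_cancel _ _).symm⟩
  have h1 := hI (det3_mem_maxMinors hv₁ hv₂ hw)
  rw [det3_expand_left] at h1
  replace h1 := (Ideal.add_mem_iff_left _
    (Ideal.mul_mem_right _ _ (Ideal.subset_span (by simp)))).1 h1
  have h2 : y ^ 3 * (c * det3 e₁ e₂ e₃) ∈ Ideal.span {x, y ^ (3 + (n - 1))} := by
    rw [show 3 + (n - 1) = 2 + n by omega]
    have h3 : y ^ 2 * det3 e₁ e₂ (y • (a • e₁ + b • e₂ + c • e₃) + x • t) =
        y ^ 3 * (c * det3 e₁ e₂ e₃) + x * (y ^ 2 * det3 e₁ e₂ t) := by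
      simp only [det3_apply, Pi.add_apply, Pi.smul_apply, smul_eq_mul]
      ring
    rw [h3] at h1
    exact (Ideal.add_mem_iff_left _
      (Ideal.mul_mem_right _ _ (Ideal.subset_span (by simp)))).1 h1
  have h4 := h.mem_of_pow_mul_mem h2
  rw [mul_comm, Ideal.unit_mul_mem_iff_mem _ hd, Ideal.mem_span_pair] at h4
  obtain ⟨p, q, rfl⟩ := h4
  refine ⟨q, t + (p * y) • e₃ - a • t₁ - b • t₂, ?_⟩
  obtain ⟨n, rfl⟩ : ∃ m, n = m + 1 := ⟨n - 1, by omega⟩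
  funext i
  simp only [Pi.add_apply, Pi.sub_apply, Pi.smul_apply, smul_eq_mul, Nat.add_sub_cancel]
  ring

end Decomposition

section Existence

variable {R : Type*} [CommRing R] [IsLocalRing R]

lemma exists_third_of_two_le [IsDomain R] {M : Submodule R (Fin 3 → R)} {x y f : R} {n : ℕ}
    (hn : 2 ≤ n) {e₁ e₂ e₃ t₁ t₂ : Fin 3 → R} (h : IsParam x y) (hx : x ≠ 0)
    (hf : IsTransverse x y f) (hM : ∀ w ∈ M, ∀ i, w i ∈ maximalIdeal R)
    (hI : maxMinors M ≤ Ideal.span {x, y ^ (2 + n)}) (hxf : x * f ∈ maxMinors M)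
    (hv₁ : y • e₁ + x • t₁ ∈ M) (hv₂ : y • e₂ + x • t₂ ∈ M) (hd : IsUnit (det3 e₁ e₂ e₃)) :
    ∃ (c : R) (t : Fin 3 → R), (c * y ^ n) • e₃ + x • t ∈ M ∧ IsUnit (det3 e₁ e₂ t) := by
  by_contra! hc
  have hc' : ∀ (c : R) (t : Fin 3 → R), (c * y ^ n) • e₃ + x • t ∈ M →
      det3 e₁ e₂ t ∈ maximalIdeal R := hc
  have hy := Ideal.pow_mem_pow h.right_mem
  refine hf.left_mul_not_mem h hx (maxMinors_le (fun w₁ hw₁ w₂ hw₂ w₃ hw₃ => ?_) hxf)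
  refine det3_mem_of_decomposition hv₁ hv₂ (fun s hs => hs.1)
    (fun w hw => exists_decomposition (by omega) h hM hI hv₁ hv₂ hd hw) ?_ ?_ hw₁ hw₂ hw₃
  · rintro _ ⟨hs, c, t, rfl⟩
    obtain ⟨k, rfl⟩ : ∃ k, n = k + 2 := ⟨n - 2, by omega⟩
    have key : det3 (y • e₁ + x • t₁) (y • e₂ + x • t₂) ((c * y ^ (k + 2)) • e₃ + x • t) =
        (c * y ^ k * det3 e₁ e₂ e₃ * y ^ 4 +
          x * y ^ 2 * (det3 e₁ e₂ t + y ^ (k + 1) * (c * (det3 e₁ t₂ e₃ + det3 t₁ e₂ e₃)))) +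
        x ^ 2 * (y * (det3 e₁ t₂ t + det3 t₁ e₂ t) +
          (c * y ^ (k + 2)) * det3 t₁ t₂ e₃ + x * det3 t₁ t₂ t) := by
      simp only [det3_apply, Pi.add_apply, Pi.smul_apply, smul_eq_mul]
      ring
    rw [key]
    refine add_mem (Submodule.mem_sup_right (add_mem (Ideal.mul_mem_left _ _ (hy 4)) ?_))
      (Submodule.mem_sup_left (Ideal.mul_mem_right _ _ (Ideal.mem_span_singleton_self _)))
    rw [show 4 = (1 + 2) + 1 from rfl, pow_succ, pow_add, pow_one]
    refine Ideal.mul_mem_mul (Ideal.mul_mem_mul h.left_mem (hy 2)) (add_mem (hc' _ _ hs) ?_)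
    exact Ideal.mul_mem_right _ _ (Ideal.pow_mem_of_mem _ h.right_mem _ (by omega))
  · rintro w hw _ ⟨-, p, s, rfl⟩ _ ⟨-, q, t, rfl⟩
    rw [det3_smul_add]
    refine add_mem (Submodule.mem_sup_right ?_)
      (Submodule.mem_sup_left (Ideal.mul_mem_right _ _ (Ideal.mem_span_singleton_self _)))
    have h2 := Ideal.pow_le_pow_right hn (hy n)
    have h3 (a b : Fin 3 → R) : det3 w a b ∈ maximalIdeal R := by
      rw [det3_rotate]
      exact det3_mem (hM w hw)
    have h4 (r : R) (a b : Fin 3 → R) : r * y ^ n * det3 w a b ∈ maximalIdeal R ^ 3 := by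
      rw [pow_succ]
      exact Ideal.mul_mem_mul (Ideal.mul_mem_left _ _ h2) (h3 a b)
    rw [pow_succ']
    exact Ideal.mul_mem_mul h.left_mem (add_mem (h4 _ _ _) (h4 _ _ _))

lemma exists_smul_add_mem {M : Submodule R (Fin 3 → R)} {x y c : R} {n : ℕ} (hn : 2 ≤ n)
    {e₁ e₂ e₃ t₁ t₂ t : Fin 3 → R} (h : IsParam x y)
    (hv₁ : y • e₁ + x • t₁ ∈ M) (hv₂ : y • e₂ + x • t₂ ∈ M)
    (hw : (c * y ^ n) • e₃ + x • t ∈ M) (hd : IsUnit (det3 e₁ e₂ t)) {k : ℕ} (hk : n ≤ k) :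
    ∃ (x' : R) (e r : Fin 3 → R), x' - x ∈ maximalIdeal R ^ n ∧ IsUnit (det3 e₁ e₂ e) ∧
      (∀ i, r i ∈ maximalIdeal R ^ k) ∧ x' • e + r ∈ M := by
  have hy := Ideal.pow_mem_pow h.right_mem
  induction k, hk using Nat.le_induction with
  | base =>
    refine ⟨x, t, _, by simp, hd, fun i => ?_, by rwa [add_comm]⟩
    exact Ideal.mul_mem_right _ _ (Ideal.mul_mem_left _ _ (hy n))
  | succ k hk ih =>
    obtain ⟨x', e, r, hx', he, hr, hM⟩ := ih
    obtain ⟨r₁, hr₁, r₂, hr₂, r₀, hr₀, rfl⟩ := exists_coeff_of_isUnit_det3 he hr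
    obtain ⟨k, rfl⟩ : ∃ m, k = m + 1 := ⟨k - 1, by omega⟩
    obtain ⟨s₁, hs₁, b₁, rfl⟩ := h.exists_of_mem_pow k hr₁
    obtain ⟨s₂, hs₂, b₂, rfl⟩ := h.exists_of_mem_pow k hr₂
    set s : Fin 3 → R := s₁ • e₁ + s₂ • e₂ - (b₁ * y ^ k) • t₁ - (b₂ * y ^ k) • t₂ with hs
    have hsm : ∀ i, s i ∈ maximalIdeal R ^ k := fun i =>
      sub_mem (sub_mem (add_mem (Ideal.mul_mem_right _ _ hs₁) (Ideal.mul_mem_right _ _ hs₂))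
        (Ideal.mul_mem_right _ _ (Ideal.mul_mem_left _ _ (hy k))))
        (Ideal.mul_mem_right _ _ (Ideal.mul_mem_left _ _ (hy k)))
    have hr₀n : r₀ ∈ maximalIdeal R ^ n := Ideal.pow_le_pow_right hk hr₀
    refine ⟨x' + r₀, e + s, -((x' - x + r₀) • s), ?_, ?_, fun i => ?_, ?_⟩
    · rw [add_sub_right_comm]
      exact add_mem hx' hr₀n
    · have hs' : det3 e₁ e₂ s ∈ maximalIdeal R :=
        det3_mem fun i => Ideal.pow_le_self (by omega) (hsm i)
      by_contra hc
      rw [map_add] at hc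
      have := sub_mem (show det3 e₁ e₂ e + det3 e₁ e₂ s ∈ maximalIdeal R from hc) hs'
      rw [add_sub_cancel_right] at this
      exact this he
    · refine neg_mem (Ideal.pow_le_pow_right (show k + 1 + 1 ≤ n + k by omega) ?_)
      rw [pow_add]
      exact Ideal.mul_mem_mul (add_mem hx' hr₀n) (hsm i)
    · convert sub_mem hM (add_mem (M.smul_mem (b₁ * y ^ k) hv₁) (M.smul_mem (b₂ * y ^ k) hv₂))
        using 1
      rw [hs]
      funext i
      simp only [Pi.add_apply, Pi.sub_apply, Pi.neg_apply, Pi.smul_apply, smul_eq_mul]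
      ring

lemma exists_third_of_one {M : Submodule R (Fin 3 → R)} {x y f : R}
    {e₁ e₂ e₃ t₁ t₂ : Fin 3 → R} (h : IsParam x y) (hf : IsTransverse x y f)
    (hM : ∀ w ∈ M, ∀ i, w i ∈ maximalIdeal R)
    (hI : maxMinors M ≤ Ideal.span {x, y ^ (2 + 1)}) (hyf : y * f ∈ maxMinors M)
    (hv₁ : y • e₁ + x • t₁ ∈ M) (hv₂ : y • e₂ + x • t₂ ∈ M) (hd : IsUnit (det3 e₁ e₂ e₃)) :
    ∃ (c : R) (t : Fin 3 → R), (c * y ^ 1) • e₃ + x • t ∈ M ∧ IsUnit c := by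
  by_contra! hc
  have hc' : ∀ (c : R) (t : Fin 3 → R), (c * y ^ 1) • e₃ + x • t ∈ M →
      c ∈ maximalIdeal R := hc
  have hx {a : R} : x * a ∈ Ideal.span {x} :=
    Ideal.mul_mem_right _ _ (Ideal.mem_span_singleton_self _)
  refine hf.right_mul_not_mem h (maxMinors_le (fun w₁ hw₁ w₂ hw₂ w₃ hw₃ => ?_) hyf)
  refine det3_mem_of_decomposition hv₁ hv₂ (fun s hs => hs.1)
    (fun w hw => exists_decomposition le_rfl h hM hI hv₁ hv₂ hd hw) ?_ ?_ hw₁ hw₂ hw₃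
  · rintro _ ⟨hs, c, t, rfl⟩
    rw [show (c * y ^ 1) • e₃ = y • c • e₃ by rw [smul_smul]; congr 1; ring, det3_expand,
      map_smul, smul_eq_mul, add_assoc]
    refine add_mem (Submodule.mem_sup_right ?_) (Submodule.mem_sup_left (add_mem ?_ ?_))
    · rw [pow_succ]
      exact Ideal.mul_mem_mul (Ideal.pow_mem_pow h.right_mem 3)
        (Ideal.mul_mem_right _ _ (hc' _ _ hs))
    · rw [mul_assoc]
      exact hx
    · rw [pow_two, mul_assoc]
      exact hx
  · rintro w hw _ ⟨-, p, s, rfl⟩ _ ⟨-, q, t, rfl⟩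
    rw [det3_smul_add, pow_two, mul_assoc x x, ← mul_add]
    exact Submodule.mem_sup_left hx

lemma exists_smul_mem_of_one [IsDomain R] {M : Submodule R (Fin 3 → R)} {x y f : R}
    {e₁ e₂ e₃ t₁ t₂ : Fin 3 → R} (h : IsParam x y) (hx : x ≠ 0) (hf : IsTransverse x y f)
    (hM : ∀ w ∈ M, ∀ i, w i ∈ maximalIdeal R)
    (hI : maxMinors M ≤ Ideal.span {x, y ^ (2 + 1)}) (hxf : x * f ∈ maxMinors M)
    (hyf : y * f ∈ maxMinors M)
    (hv₁ : y • e₁ + x • t₁ ∈ M) (hv₂ : y • e₂ + x • t₂ ∈ M) (hd : IsUnit (det3 e₁ e₂ e₃)) :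
    ∃ e₁ e₂ t₁ t₂ e : Fin 3 → R, y • e₁ + x • t₁ ∈ M ∧ y • e₂ + x • t₂ ∈ M ∧ x • e ∈ M ∧
      IsUnit (det3 e₁ e₂ e) := by
  obtain ⟨c, t₃, hv₃, hc⟩ := exists_third_of_one h hf hM hI hyf hv₁ hv₂ hd
  obtain ⟨c', hcc'⟩ := hc.exists_left_inv
  have hd' : IsUnit (det3 e₁ e₂ (c • e₃)) := by
    rw [map_smul, smul_eq_mul]
    exact hc.mul hd
  have hv₃' : y • c • e₃ + x • t₃ ∈ M := by
    rwa [show (c * y ^ 1) • e₃ = y • c • e₃ by rw [smul_smul]; congr 1; ring] at hv₃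
  have hdec : ∀ w ∈ M, ∃ p q r : R, ∃ s : Fin 3 → R, x • s ∈ M ∧
      w = (p • (y • e₁ + x • t₁) + q • (y • e₂ + x • t₂) + r • (y • c • e₃ + x • t₃)) + x • s := by
    intro w hw
    obtain ⟨a, b, _, ⟨hs, r, s, rfl⟩, rfl⟩ := exists_decomposition le_rfl h hM hI hv₁ hv₂ hd hw
    have he : (r * y ^ 1) • e₃ + x • s - (r * c') • (y • c • e₃ + x • t₃) =
        x • (s - (r * c') • t₃) := by
      funext i
      simp only [Pi.add_apply, Pi.sub_apply, Pi.smul_apply, smul_eq_mul]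
      linear_combination -(r * y * e₃ i) * hcc'
    refine ⟨a, b, r * c', s - (r * c') • t₃, ?_, ?_⟩
    · rw [← he]
      exact sub_mem hs (M.smul_mem _ hv₃')
    · rw [← he]
      abel
  by_cases hex : ∃ e : Fin 3 → R, x • e ∈ M ∧ ∃ i, IsUnit (e i)
  · obtain ⟨e, he, i, hi⟩ := hex
    by_contra! hno
    have hno' : ∀ e₁ e₂ t₁ t₂ : Fin 3 → R, y • e₁ + x • t₁ ∈ M → y • e₂ + x • t₂ ∈ M →
        det3 e₁ e₂ e ∈ maximalIdeal R := fun _ _ _ _ h₁ h₂ => hno _ _ _ _ _ h₁ h₂ he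
    have hz : det3 e₁ e₂ (c • e₃) * e i ∈ maximalIdeal R := by
      have := congrFun (det3_mul_eq e₁ e₂ (c • e₃) e) i
      rw [Pi.smul_apply, smul_eq_mul] at this
      rw [this]
      exact add_mem (add_mem (Ideal.mul_mem_right _ _ (hno' _ _ _ _ hv₂ hv₃'))
        (Ideal.mul_mem_right _ _ (hno' _ _ _ _ hv₃' hv₁)))
        (Ideal.mul_mem_right _ _ (hno' _ _ _ _ hv₁ hv₂))
    exact hz (hd'.mul hi)
  exfalso
  push Not at hex
  have hex' : ∀ e : Fin 3 → R, x • e ∈ M → ∀ i, e i ∈ maximalIdeal R := hex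
  set d := det3 (y • e₁ + x • t₁) (y • e₂ + x • t₂) (y • c • e₃ + x • t₃) with hdd
  have h4 : ∀ s a b : Fin 3 → R, x • s ∈ M → a ∈ M → b ∈ M →
      x * det3 s a b ∈ maximalIdeal R ^ 4 := by
    intro s a b hs ha hb
    rw [det3_rotate, det3_rotate, pow_succ', pow_succ', pow_two, ← det3_rotate]
    refine Ideal.mul_mem_mul h.left_mem ?_
    rw [det3_apply]
    have hm (i j k : Fin 3) : s i * (a j * b k) ∈
        maximalIdeal R * (maximalIdeal R * maximalIdeal R) :=
      Ideal.mul_mem_mul (hex' s hs i) (Ideal.mul_mem_mul (hM a ha j) (hM b hb k))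
    convert add_mem (add_mem (sub_mem (hm 0 1 2) (hm 0 2 1)) (sub_mem (hm 1 2 0) (hm 1 0 2)))
      (sub_mem (hm 2 0 1) (hm 2 1 0)) using 1
    ring
  have hle : maxMinors M ≤ Ideal.span {d} ⊔ maximalIdeal R ^ 4 := by
    refine maxMinors_le fun w₁ hw₁ w₂ hw₂ w₃ hw₃ => ?_
    have h12 : ∀ p q r : R, p • (y • e₁ + x • t₁) + q • (y • e₂ + x • t₂) +
        r • (y • c • e₃ + x • t₃) ∈ M := fun p q r =>
      add_mem (add_mem (M.smul_mem _ hv₁) (M.smul_mem _ hv₂)) (M.smul_mem _ hv₃')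
    obtain ⟨p₁, q₁, r₁, s₁, hs₁, he₁⟩ := hdec _ hw₁
    obtain ⟨p₂, q₂, r₂, s₂, hs₂, he₂⟩ := hdec _ hw₂
    obtain ⟨p₃, q₃, r₃, s₃, hs₃, he₃⟩ := hdec _ hw₃
    have hu₁ := h12 p₁ q₁ r₁
    have hu₂ := h12 p₂ q₂ r₂
    have key : ∀ v₁ v₂ v₃ : Fin 3 → R, det3 (p₁ • v₁ + q₁ • v₂ + r₁ • v₃)
        (p₂ • v₁ + q₂ • v₂ + r₂ • v₃) (p₃ • v₁ + q₃ • v₂ + r₃ • v₃) = det3 v₁ v₂ v₃ *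
          (p₁ * (q₂ * r₃ - q₃ * r₂) - q₁ * (p₂ * r₃ - p₃ * r₂) + r₁ * (p₂ * q₃ - p₃ * q₂)) := by
      intro v₁ v₂ v₃
      simp only [det3_apply, Pi.add_apply, Pi.smul_apply, smul_eq_mul]
      ring
    have key' : ∀ u₁ u₂ u₃ : Fin 3 → R, det3 (u₁ + x • s₁) (u₂ + x • s₂) (u₃ + x • s₃) =
        det3 u₁ u₂ u₃ + (x * det3 s₃ u₁ u₂ + x * det3 s₂ (u₃ + x • s₃) u₁ +
          x * det3 s₁ (u₂ + x • s₂) (u₃ + x • s₃)) := by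
      intro u₁ u₂ u₃
      simp only [det3_apply, Pi.add_apply, Pi.smul_apply, smul_eq_mul]
      ring
    rw [he₁, he₂, he₃, key', key, ← he₃, ← he₂]
    exact add_mem (Submodule.mem_sup_left (Ideal.mul_mem_right _ _
      (Ideal.mem_span_singleton_self _)))
      (Submodule.mem_sup_right (add_mem (add_mem (h4 _ _ _ hs₃ hu₁ hu₂) (h4 _ _ _ hs₂ hw₃ hu₁))
        (h4 _ _ _ hs₁ hw₂ hw₃)))
  obtain ⟨_, hg, z, hz, hgz⟩ := Submodule.mem_sup.1 (hle hxf)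
  obtain ⟨g, rfl⟩ := Ideal.mem_span_singleton.1 hg
  obtain ⟨_, hg', z', hz', hgz'⟩ := Submodule.mem_sup.1 (hle hyf)
  obtain ⟨g', rfl⟩ := Ideal.mem_span_singleton.1 hg'
  by_cases hgu : IsUnit g
  · obtain ⟨v, hv⟩ := hgu.exists_left_inv
    obtain ⟨u, a, hu, rfl⟩ := hf.exists_eq h
    refine h.unit_mul_pow_ne (i := 3) (u := u) (a := g' * v * (x * a + u * y ^ 2) - y * a)
      (z := z' - g' * v * z) hu (sub_mem hz' (Ideal.mul_mem_left _ _ hz)) ?_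
    linear_combination -hgz' + g' * v * hgz - g' * d * hv
  · have hd3 : d ∈ maximalIdeal R ^ 3 := by
      rw [hdd, ← det3_rotate, ← det3_rotate, det3_apply, pow_succ', pow_two]
      have hm (i j k : Fin 3) : (y • e₂ + x • t₂) i * ((y • c • e₃ + x • t₃) j *
          (y • e₁ + x • t₁) k) ∈ maximalIdeal R * (maximalIdeal R * maximalIdeal R) :=
        Ideal.mul_mem_mul (hM _ hv₂ i) (Ideal.mul_mem_mul (hM _ hv₃' j) (hM _ hv₁ k))
      convert add_mem (add_mem (sub_mem (hm 0 1 2) (hm 0 2 1)) (sub_mem (hm 1 2 0) (hm 1 0 2)))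
        (sub_mem (hm 2 0 1) (hm 2 1 0)) using 1
      ring
    have hxf4 : x * f ∈ maximalIdeal R ^ (3 + 1) := by
      rw [← hgz]
      refine add_mem ?_ hz
      rw [pow_succ]
      exact Ideal.mul_mem_mul hd3 hgu
    obtain ⟨u, a, hu, hf'⟩ := hf.exists_eq h
    exact h.unit_mul_pow_ne (i := 2) (a := -a) hu (h.mem_pow_of_mul_mem hx hxf4)
      (by rw [hf']; ring)

end Existence

/-- main non-existence result: let `J, K` be integrally closed `𝔪`-primary
ideals of orders `1` and `2` with `λ(R/JK) − λ(R/J) − λ(R/K) = 2` and `𝔪² = J𝔪 + K`.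
Then any integrally closed module `M` of rank `3` without free direct summands with
`I(M) = JK` is decomposable. -/
theorem statement18 (R : Type*) [CommRing R] [IsLocalRing R]
    (hreg : IsTwoDimRegularLocal R) [Infinite (IsLocalRing.ResidueField R)]
    (J K : Ideal R) (hJc : IdealIntClosed J) (hJp : IsMPrimary J)
    (hKc : IdealIntClosed K) (hKp : IsMPrimary K)
    (hJo : ordEQ J 1) (hKo : ordEQ K 2)
    (hlen : modLength R (R ⧸ (J * K)) =
      modLength R (R ⧸ J) + modLength R (R ⧸ K) + ((2 : ℕ) : WithBot ℕ∞))
    (hmk : maximalIdeal R ^ 2 = J * maximalIdeal R + K)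
    (M : Submodule R (Fin 3 → R)) (h1 : FinColength M) (h2 : ModIntClosed M)
    (h3 : ¬ HasFreeSummand M) (h4 : maxMinors M = J * K) :
    DecomposableSub M := by
  have := hreg.1
  have := isDomain_of_isTwoDimRegularLocal hreg
  obtain ⟨x, y, f, n, h, hf, hfK, hn, hJ⟩ := exists_generators hreg hJp hJo hKo hmk
  have hx : x ≠ 0 := h.left_ne_zero hreg
  have hxJ : x ∈ J := hJ ▸ Ideal.subset_span (by simp)
  have hM : ∀ w ∈ M, ∀ i, w i ∈ maximalIdeal R := fun w hw =>
    mem_maximalIdeal_of_not_hasFreeSummand h3 hw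
  obtain ⟨N, hN⟩ := exists_pow_le_mul hJp hKp
  rw [← h4] at hN
  have hI0 : maxMinors M ≠ ⊥ := fun hc =>
    pow_ne_zero N hx (by simpa [hc] using hN (Ideal.pow_mem_pow h.left_mem N))
  have hI : maxMinors M ≤ Ideal.span {x, y ^ (2 + n)} := by
    rw [h4, hJ]
    refine (Ideal.mul_mono_right (hKo.1.trans (h.pow_le 2))).trans ?_
    rw [Ideal.mul_le]
    intro a ha b hb
    obtain ⟨p, q, rfl⟩ := Ideal.mem_span_pair.1 ha
    obtain ⟨r, s, rfl⟩ := Ideal.mem_span_pair.1 hb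
    exact Ideal.mem_span_pair.2 ⟨p * (r * x + s * y ^ 2) + q * y ^ n * r, q * s, by ring⟩
  have hxf : x * f ∈ maxMinors M := h4 ▸ Ideal.mul_mem_mul hxJ hfK
  obtain ⟨e₁, e₂, e₃, t₁, t₂, hv₁, hv₂, hd⟩ := exists_pair_mem h hx hf hM hxf
  rcases hn.eq_or_lt with rfl | hn2
  · have hyJ : y ∈ J := hJ ▸ Ideal.subset_span (by simp)
    obtain ⟨e₁, e₂, t₁, t₂, e, hv₁, hv₂, he, hd⟩ := exists_smul_mem_of_one h hx hf hM hI hxf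
      (h4 ▸ Ideal.mul_mem_mul hyJ hfK) hv₁ hv₂ hd
    exact decomposableSub_of_smul_mem h hx hJ hI hI0 hv₁ hv₂ hd fun j hj =>
      h2.smul_mem_of_smul_mem h4
        (fun s => mem_of_mul_mem_of_transverse hJp hKp hlen h hx hf hxJ hfK) he hj
  · obtain ⟨c, t, hw, ht⟩ := exists_third_of_two_le hn2 h hx hf hM hI hxf hv₁ hv₂ hd
    obtain ⟨x', e, r, hx', hd, hr, he⟩ :=
      exists_smul_add_mem hn2 h hv₁ hv₂ hw ht (le_max_left n N)
    have hrM : r ∈ M := h2.mem_of_forall_mem fun i =>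
      hN (Ideal.pow_le_pow_right (le_max_right n N) (hr i))
    have heM : x' • e ∈ M := by simpa using sub_mem he hrM
    have hx2 := Ideal.pow_le_pow_right hn2 hx'
    have h' := h.add_left hreg hx2
    have hf' := hf.add_left (y := y) hx2
    have hxJ' : x + (x' - x) ∈ J := add_mem hxJ (hJ ▸ h.pow_le n hx')
    rw [add_sub_cancel] at h' hf' hxJ'
    exact decomposableSub_of_smul_mem h hx hJ hI hI0 hv₁ hv₂ hd fun j hj =>
      h2.smul_mem_of_smul_mem h4 (fun s => mem_of_mul_mem_of_transverse hJp hKp hlen h'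
        (h'.left_ne_zero hreg) hf' hxJ' hfK) heM hj
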